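/- Let R_1, …, R_p be incommensurate cocompact lattices in R^d, Γ_j = R^d / R_j, and Ω = Γ_1 × ⋯ × Γ_p with diagonal translation action T. Then the system (Ω, R^d, T) is uniquely ergodic: any Borel probability measure μ on Ω that is invariant under T_a for all a ∈ R^d is equal to the normalized Haar product measure P. -/

import Mathlib

open scoped RealInnerProductSpace
open Filter MeasureTheory

/-- The cocompact lattice `R = E·ℤ^d` in `ℝ^d`. -/
noncomputable def latticeSet {d : ℕ} (E : Matrix (Fin d) (Fin d) ℝ) :
    Set (EuclideanSpace ℝ (Fin d)) :=
  Set.range fun m : Fin d → ℤ =>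
    (EuclideanSpace.equiv (Fin d) ℝ).symm (E.mulVec fun j => (m j : ℝ))

/-- The dual lattice `R* = {k : k·n ∈ ℤ for all n ∈ R}`. -/
noncomputable def dualLattice {d : ℕ} (E : Matrix (Fin d) (Fin d) ℝ) :
    Set (EuclideanSpace ℝ (Fin d)) :=
  {k | ∀ n ∈ latticeSet E, ∃ z : ℤ, ⟪k, n⟫ = (z : ℝ)}

/-- The lattice `R` as an additive subgroup of `ℝ^d` (the set `latticeSet E` is already closed
under the group operations, so the closure adds nothing). -/
noncomputable def latticeGroup {d : ℕ} (E : Matrix (Fin d) (Fin d) ℝ) :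
    AddSubgroup (EuclideanSpace ℝ (Fin d)) :=
  AddSubgroup.closure (latticeSet E)

/-- The quotient torus `Γ = ℝ^d / R`. -/
abbrev QuotTorus {d : ℕ} (E : Matrix (Fin d) (Fin d) ℝ) : Type :=
  EuclideanSpace ℝ (Fin d) ⧸ latticeGroup E

/-- The fundamental cell `Γ̂ = E·[−1/2, 1/2)^d`. -/
noncomputable def fundamentalCell {d : ℕ} (E : Matrix (Fin d) (Fin d) ℝ) :
    Set (EuclideanSpace ℝ (Fin d)) :=
  Set.image (fun t : Fin d → ℝ => (EuclideanSpace.equiv (Fin d) ℝ).symm (E.mulVec t))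
    {t | ∀ i, t i ∈ Set.Ico (-(1/2) : ℝ) (1/2)}

/-- The Haar measure on `ℝ^d / R` normalized to total mass `|Γ| = |det E|`, i.e., the
pushforward of the Lebesgue measure on the fundamental cell by the quotient map. -/
noncomputable def haarCell {d : ℕ} (E : Matrix (Fin d) (Fin d) ℝ) : Measure (QuotTorus E) :=
  Measure.map QuotientAddGroup.mk (volume.restrict (fundamentalCell E))

/-- The normalized Haar probability measure on the quotient torus `ℝ^d / R`. -/
noncomputable def haarProb {d : ℕ} (E : Matrix (Fin d) (Fin d) ℝ) : Measure (QuotTorus E) :=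
  (ENNReal.ofReal |E.det|)⁻¹ • haarCell E

/-- The hull `Ω = Γ_1 × ⋯ × Γ_p`. -/
abbrev Hull {d p : ℕ} (E : Fin p → Matrix (Fin d) (Fin d) ℝ) : Type :=
  (j : Fin p) → QuotTorus (E j)

/-- The normalized Haar product probability measure `P` on `Ω`. -/
noncomputable def hullProb {d p : ℕ} (E : Fin p → Matrix (Fin d) (Fin d) ℝ) :
    Measure (Hull E) :=
  Measure.pi fun j => haarProb (E j)

/-- The diagonal translation `T_a(γ_1, …, γ_p) = (γ_1 + a, …, γ_p + a)` on `Ω`. -/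
noncomputable def diagT {d p : ℕ} (E : Fin p → Matrix (Fin d) (Fin d) ℝ)
    (a : EuclideanSpace ℝ (Fin d)) : Hull E → Hull E :=
  fun ω j => ω j + QuotientAddGroup.mk a

/-- The lattices `R_1, …, R_p` are incommensurate: a tuple of dual vectors sums to zero only
if all of them vanish. -/
def Incommensurate {d p : ℕ} (E : Fin p → Matrix (Fin d) (Fin d) ℝ) : Prop :=
  ∀ k : Fin p → EuclideanSpace ℝ (Fin d), (∀ j, k j ∈ dualLattice (E j)) →
    ((∑ j, k j) = 0 ↔ ∀ j, k j = 0)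


open scoped BoundedContinuousFunction

/-- Coordinates w.r.t. the lattice basis. -/
noncomputable def coordL {d : ℕ} (E : Matrix (Fin d) (Fin d) ℝ) (x : EuclideanSpace ℝ (Fin d)) :
    Fin d → ℝ := E⁻¹.mulVec (WithLp.ofLp x)

lemma coordL_add {d : ℕ} (E : Matrix (Fin d) (Fin d) ℝ) (x y : EuclideanSpace ℝ (Fin d)) :
    coordL E (x + y) = coordL E x + coordL E y := by
  simp [coordL, Matrix.mulVec_add]

lemma coordL_continuous {d : ℕ} (E : Matrix (Fin d) (Fin d) ℝ) : Continuous (coordL E) := by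
  unfold coordL
  fun_prop

lemma coordL_mulVec {d : ℕ} {E : Matrix (Fin d) (Fin d) ℝ} (hE : IsUnit E.det) (t : Fin d → ℝ) :
    coordL E ((EuclideanSpace.equiv (Fin d) ℝ).symm (E.mulVec t)) = t := by
  simp [coordL, Matrix.mulVec_mulVec, Matrix.nonsing_inv_mul E hE]

lemma mulVec_coordL {d : ℕ} {E : Matrix (Fin d) (Fin d) ℝ} (hE : IsUnit E.det)
    (x : EuclideanSpace ℝ (Fin d)) :
    (EuclideanSpace.equiv (Fin d) ℝ).symm (E.mulVec (coordL E x)) = x := by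
  simp [coordL, Matrix.mulVec_mulVec, Matrix.mul_nonsing_inv E hE]

/-- coordinates mod 1 -/
noncomputable def coordHom {d : ℕ} (E : Matrix (Fin d) (Fin d) ℝ) :
    EuclideanSpace ℝ (Fin d) →+ (Fin d → AddCircle (1 : ℝ)) :=
  AddMonoidHom.mk' (fun x i => ((coordL E x i : ℝ) : AddCircle (1 : ℝ))) (by
    intro a b
    ext i
    simp [coordL_add])

lemma coordHom_apply {d : ℕ} (E : Matrix (Fin d) (Fin d) ℝ) (x : EuclideanSpace ℝ (Fin d))
    (i : Fin d) : coordHom E x i = ((coordL E x i : ℝ) : AddCircle (1 : ℝ)) := rfl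

lemma coordHom_continuous {d : ℕ} (E : Matrix (Fin d) (Fin d) ℝ) : Continuous (coordHom E) := by
  refine continuous_pi fun i => ?_
  exact (AddCircle.continuous_mk' (1 : ℝ)).comp ((continuous_apply i).comp (coordL_continuous E))

lemma coordHom_eq_zero {d : ℕ} {E : Matrix (Fin d) (Fin d) ℝ} (hE : IsUnit E.det)
    (x : EuclideanSpace ℝ (Fin d)) : coordHom E x = 0 ↔ x ∈ latticeSet E := by
  constructor
  · intro h
    have h' : ∀ i, ∃ z : ℤ, (z : ℝ) = coordL E x i := by
      intro i
      have := congrFun h i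
      rw [coordHom_apply, Pi.zero_apply, AddCircle.coe_eq_zero_iff] at this
      simpa using this
    choose m hm using h'
    refine ⟨m, ?_⟩
    simp only [hm]
    exact mulVec_coordL hE x
  · rintro ⟨m, rfl⟩
    ext i
    rw [coordHom_apply, coordL_mulVec hE, Pi.zero_apply, AddCircle.coe_eq_zero_iff]
    exact ⟨m i, by simp⟩

lemma latticeGroup_eq_ker {d : ℕ} {E : Matrix (Fin d) (Fin d) ℝ} (hE : IsUnit E.det) :
    latticeGroup E = (coordHom E).ker := by
  apply le_antisymm
  · rw [latticeGroup, AddSubgroup.closure_le]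
    intro x hx
    exact (coordHom_eq_zero hE x).2 hx
  · intro x hx
    exact AddSubgroup.subset_closure ((coordHom_eq_zero hE x).1 hx)

lemma mem_latticeGroup {d : ℕ} {E : Matrix (Fin d) (Fin d) ℝ} (hE : IsUnit E.det)
    (x : EuclideanSpace ℝ (Fin d)) : x ∈ latticeGroup E ↔ x ∈ latticeSet E := by
  rw [latticeGroup_eq_ker hE, AddMonoidHom.mem_ker, coordHom_eq_zero hE]

lemma latticeGroup_closed {d : ℕ} {E : Matrix (Fin d) (Fin d) ℝ} (hE : IsUnit E.det) :
    IsClosed (latticeGroup E : Set (EuclideanSpace ℝ (Fin d))) := by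
  rw [latticeGroup_eq_ker hE]
  exact isClosed_singleton.preimage (coordHom_continuous E)

lemma latticeGroup_countable {d : ℕ} {E : Matrix (Fin d) (Fin d) ℝ} (hE : IsUnit E.det) :
    Countable (latticeGroup E) := by
  have : (latticeGroup E : Set (EuclideanSpace ℝ (Fin d))) = latticeSet E := by
    ext x; exact mem_latticeGroup hE x
  have h2 : (latticeGroup E : Set (EuclideanSpace ℝ (Fin d))).Countable := by
    rw [this]; exact Set.countable_range _
  exact h2.to_subtype

/-- coordinates mod 1 on the quotient -/
noncomputable def quotHom {d : ℕ} {E : Matrix (Fin d) (Fin d) ℝ} (hE : IsUnit E.det) :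
    QuotTorus E →+ (Fin d → AddCircle (1 : ℝ)) :=
  QuotientAddGroup.lift (latticeGroup E) (coordHom E) (latticeGroup_eq_ker hE).le

lemma quotHom_mk {d : ℕ} {E : Matrix (Fin d) (Fin d) ℝ} (hE : IsUnit E.det)
    (x : EuclideanSpace ℝ (Fin d)) :
    quotHom hE (QuotientAddGroup.mk x) = coordHom E x := rfl

lemma quotHom_continuous {d : ℕ} {E : Matrix (Fin d) (Fin d) ℝ} (hE : IsUnit E.det) :
    Continuous (quotHom hE) :=
  Continuous.quotient_lift (coordHom_continuous E) _

lemma quotHom_injective {d : ℕ} {E : Matrix (Fin d) (Fin d) ℝ} (hE : IsUnit E.det) :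
    Function.Injective (quotHom hE) := by
  rw [injective_iff_map_eq_zero]
  intro a
  induction a using QuotientAddGroup.induction_on with
  | H x =>
    intro h
    rw [quotHom_mk] at h
    rw [QuotientAddGroup.eq_zero_iff, latticeGroup_eq_ker hE]
    exact h

lemma quot_polish {d : ℕ} {E : Matrix (Fin d) (Fin d) ℝ} (hE : IsUnit E.det) :
    PolishSpace (QuotTorus E) ∧ BorelSpace (QuotTorus E) := by
  have := latticeGroup_closed hE
  let : NormedAddCommGroup (QuotTorus E) := QuotientAddGroup.instNormedAddCommGroup _
  have : SecondCountableTopology (QuotTorus E) := inferInstance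
  have : CompleteSpace (QuotTorus E) :=
    QuotientAddGroup.completeSpace_left (EuclideanSpace ℝ (Fin d)) (latticeGroup E)
  exact ⟨inferInstance, inferInstance⟩

lemma cell_fund {d : ℕ} {E : Matrix (Fin d) (Fin d) ℝ} (hE : IsUnit E.det) :
    IsAddFundamentalDomain (latticeGroup E).op (fundamentalCell E) volume := by
  have hcell : fundamentalCell E = coordL E ⁻¹' {t | ∀ i, t i ∈ Set.Ico (-(1/2) : ℝ) (1/2)} := by
    ext x
    constructor
    · rintro ⟨t, ht, rfl⟩
      rw [Set.mem_preimage, coordL_mulVec hE]; exact ht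
    · intro hx
      exact ⟨coordL E x, hx, mulVec_coordL hE x⟩
  have hmeas : MeasurableSet (fundamentalCell E) := by
    rw [hcell]
    apply (coordL_continuous E).measurable
    have : {t : Fin d → ℝ | ∀ i, t i ∈ Set.Ico (-(1/2) : ℝ) (1/2)}
        = Set.univ.pi fun _ => Set.Ico (-(1/2) : ℝ) (1/2) := by ext; simp
    rw [this]
    exact MeasurableSet.univ_pi fun _ => measurableSet_Ico
  apply IsAddFundamentalDomain.mk' hmeas.nullMeasurableSet
  intro x
  have h1 := fun i => existsUnique_add_zsmul_mem_Ico (zero_lt_one' ℝ) (coordL E x i) (-(1/2))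
  choose m hm hmu using h1
  have hmem : (EuclideanSpace.equiv (Fin d) ℝ).symm (E.mulVec fun j => (m j : ℝ)) ∈ latticeGroup E :=
    (mem_latticeGroup hE _).2 ⟨m, rfl⟩
  refine ⟨⟨AddOpposite.op _, AddSubgroup.mem_op.2 hmem⟩, ?_, ?_⟩
  · show x + (EuclideanSpace.equiv (Fin d) ℝ).symm (E.mulVec fun j => (m j : ℝ)) ∈ _
    rw [hcell, Set.mem_preimage, coordL_add, coordL_mulVec hE]
    intro i
    have := hm i
    norm_num at this ⊢
    exact this
  · rintro ⟨g, hg⟩ hgx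
    obtain ⟨m', hm'⟩ := (mem_latticeGroup hE _).1 (AddSubgroup.mem_op.1 hg)
    have hgx' : x + g.unop ∈ fundamentalCell E := hgx
    rw [← hm', hcell, Set.mem_preimage, coordL_add, coordL_mulVec hE] at hgx'
    have : m' = m := by
      ext i
      apply hmu i
      have := hgx' i
      norm_num at this ⊢
      exact this
    apply Subtype.ext
    apply AddOpposite.unop_injective
    subst this
    exact hm'.symm

lemma cell_volume {d : ℕ} (E : Matrix (Fin d) (Fin d) ℝ) :
    volume (fundamentalCell E) = ENNReal.ofReal |E.det| := by
  have h : fundamentalCell E = (WithLp.toLp 2) ''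
      ((Matrix.toLin' E) '' (Set.univ.pi fun _ => Set.Ico (-(1/2) : ℝ) (1/2))) := by
    rw [Set.image_image]
    unfold fundamentalCell
    congr 1
    ext; simp
  have h2 := (PiLp.volume_preserving_toLp (Fin d)).measure_preimage_equiv (f := MeasurableEquiv.toLp 2 (Fin d → ℝ))
    (fundamentalCell E)
  rw [← h2, h]
  erw [Set.preimage_image_eq _ (MeasurableEquiv.toLp 2 (Fin d → ℝ)).injective]
  rw [Measure.addHaar_image_linearMap, Real.volume_pi_Ico]
  norm_num

lemma haarProb_props {d : ℕ} {E : Matrix (Fin d) (Fin d) ℝ} (hE : IsUnit E.det) :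
    IsProbabilityMeasure (haarProb E) ∧ (haarProb E).IsAddLeftInvariant := by
  have := latticeGroup_closed hE
  have := latticeGroup_countable hE
  obtain ⟨hp, hb⟩ := quot_polish hE
  have hmk : Measurable (QuotientAddGroup.mk : _ → QuotTorus E) :=
    (QuotientAddGroup.continuous_mk).measurable
  constructor
  · constructor
    rw [haarProb, haarCell, Measure.smul_apply, Measure.map_apply hmk MeasurableSet.univ]
    rw [Set.preimage_univ, Measure.restrict_apply_univ, cell_volume, smul_eq_mul]
    apply ENNReal.inv_mul_cancel
    · simpa using hE.ne_zero
    · simp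
  · have hf := cell_fund hE
    have : HasAddFundamentalDomain (latticeGroup E).op (EuclideanSpace ℝ (Fin d)) volume :=
      ⟨⟨_, hf⟩⟩
    have : Countable (latticeGroup E).op := (latticeGroup E).equivOp.symm.injective.countable
    have : AddQuotientMeasureEqMeasurePreimage volume (haarCell E) :=
      hf.addQuotientMeasureEqMeasurePreimage rfl
    have : (haarCell E).IsAddLeftInvariant :=
      AddQuotientMeasureEqMeasurePreimage.addInvariantMeasure_quotient volume
    rw [haarProb]
    infer_instance

lemma hullProb_inv {d p : ℕ} (E : Fin p → Matrix (Fin d) (Fin d) ℝ)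
    (hE : ∀ j, IsUnit (E j).det) :
    IsProbabilityMeasure (hullProb E) ∧
      ∀ a, Measure.map (diagT E a) (hullProb E) = hullProb E := by
  have := fun j => (haarProb_props (hE j)).1
  have := fun j => (haarProb_props (hE j)).2
  have := fun j => latticeGroup_closed (hE j)
  have := fun j => (quot_polish (hE j)).1
  have := fun j => (quot_polish (hE j)).2
  constructor
  · unfold hullProb; infer_instance
  · intro a
    have := measurePreserving_pi (fun j => haarProb (E j)) (fun j => haarProb (E j))
      (f := fun j x => (QuotientAddGroup.mk a : QuotTorus (E j)) + x)
      (fun j => measurePreserving_add_left _ _)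
    have h2 := this.map_eq
    unfold hullProb
    convert h2 using 2
    ext ω j
    exact add_comm _ _

/-- the phase attached to an integer vector -/
noncomputable def phase {d p : ℕ} {E : Fin p → Matrix (Fin d) (Fin d) ℝ}
    (hE : ∀ j, IsUnit (E j).det) (n : Fin p → Fin d → ℤ) (ω : Hull E) : AddCircle (1 : ℝ) :=
  ∑ j, ∑ i, n j i • quotHom (hE j) (ω j) i

/-- the character attached to an integer vector -/
noncomputable def chi {d p : ℕ} {E : Fin p → Matrix (Fin d) (Fin d) ℝ}
    (hE : ∀ j, IsUnit (E j).det) (n : Fin p → Fin d → ℤ) : Hull E →ᵇ ℂ :=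
  BoundedContinuousFunction.ofNormedAddCommGroup
    (fun ω => ((phase hE n ω).toCircle : ℂ))
    (by
      refine continuous_subtype_val.comp (AddCircle.continuous_toCircle.comp ?_)
      refine continuous_finsetSum _ fun j _ => continuous_finsetSum _ fun i _ => ?_
      exact ((continuous_apply i).comp ((quotHom_continuous (hE j)).comp
        (continuous_apply j))).zsmul _)
    1 (fun ω => (Circle.norm_coe _).le)

lemma chi_apply {d p : ℕ} {E : Fin p → Matrix (Fin d) (Fin d) ℝ}
    (hE : ∀ j, IsUnit (E j).det) (n : Fin p → Fin d → ℤ) (ω : Hull E) :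
    chi hE n ω = ((phase hE n ω).toCircle : ℂ) := rfl

lemma chi_zero {d p : ℕ} {E : Fin p → Matrix (Fin d) (Fin d) ℝ}
    (hE : ∀ j, IsUnit (E j).det) : chi hE 0 = 1 := by
  ext ω
  simp [chi_apply, phase]

lemma chi_add {d p : ℕ} {E : Fin p → Matrix (Fin d) (Fin d) ℝ}
    (hE : ∀ j, IsUnit (E j).det) (m n : Fin p → Fin d → ℤ) :
    chi hE (m + n) = chi hE m * chi hE n := by
  ext ω
  simp [chi_apply, phase, add_zsmul, Finset.sum_add_distrib, AddCircle.toCircle_add]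

lemma chi_neg {d p : ℕ} {E : Fin p → Matrix (Fin d) (Fin d) ℝ}
    (hE : ∀ j, IsUnit (E j).det) (n : Fin p → Fin d → ℤ) :
    chi hE (-n) = star (chi hE n) := by
  ext ω
  simp only [chi_apply, phase, Pi.neg_apply, neg_zsmul, Finset.sum_neg_distrib,
    AddCircle.toCircle_neg, Circle.coe_inv_eq_conj, BoundedContinuousFunction.star_apply]
  rfl

lemma phase_diagT {d p : ℕ} {E : Fin p → Matrix (Fin d) (Fin d) ℝ}
    (hE : ∀ j, IsUnit (E j).det) (n : Fin p → Fin d → ℤ) (a : EuclideanSpace ℝ (Fin d))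
    (ω : Hull E) : phase hE n (diagT E a ω) =
      phase hE n ω + ((∑ j, ∑ i, (n j i : ℝ) * coordL (E j) a i : ℝ) : AddCircle (1 : ℝ)) := by
  have h : ∀ j i, (n j i) • ((coordL (E j) a i : ℝ) : AddCircle (1 : ℝ))
      = (((n j i : ℝ) * coordL (E j) a i : ℝ) : AddCircle (1 : ℝ)) := by
    intro j i
    rw [← AddCircle.coe_zsmul, zsmul_eq_mul]
  have hs : ∀ {ι : Type} (s : Finset ι) (f : ι → ℝ),
      ((∑ i ∈ s, f i : ℝ) : AddCircle (1 : ℝ)) = ∑ i ∈ s, (f i : AddCircle (1 : ℝ)) :=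
    fun s f => map_sum (QuotientAddGroup.mk' (AddSubgroup.zmultiples (1 : ℝ))) f s
  simp only [phase, diagT, map_add, quotHom_mk, Pi.add_apply, zsmul_add, Finset.sum_add_distrib,
    coordHom_apply, h, hs]

/-- The dual vector attached to an integer vector. -/
noncomputable def dualVec {d : ℕ} (E : Matrix (Fin d) (Fin d) ℝ) (n : Fin d → ℤ) :
    EuclideanSpace ℝ (Fin d) :=
  WithLp.toLp 2 (Matrix.vecMul (fun i => (n i : ℝ)) E⁻¹)

lemma inner_dualVec {d : ℕ} (E : Matrix (Fin d) (Fin d) ℝ) (n : Fin d → ℤ)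
    (a : EuclideanSpace ℝ (Fin d)) :
    ⟪dualVec E n, a⟫ = ∑ i, (n i : ℝ) * coordL E a i := by
  have : ⟪dualVec E n, a⟫ = Matrix.vecMul (fun i => (n i : ℝ)) E⁻¹ ⬝ᵥ (WithLp.ofLp a) := by
    simp [dualVec, PiLp.inner_apply, dotProduct, mul_comm]
  rw [this, ← Matrix.dotProduct_mulVec]
  rfl

lemma dualVec_mem {d : ℕ} {E : Matrix (Fin d) (Fin d) ℝ} (hE : IsUnit E.det) (n : Fin d → ℤ) :
    dualVec E n ∈ dualLattice E := by
  rintro _ ⟨m, rfl⟩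
  refine ⟨∑ i, n i * m i, ?_⟩
  rw [inner_dualVec, coordL_mulVec hE]
  push_cast
  rfl

lemma dualVec_eq_zero {d : ℕ} {E : Matrix (Fin d) (Fin d) ℝ} (hE : IsUnit E.det) (n : Fin d → ℤ)
    (h : dualVec E n = 0) : n = 0 := by
  ext i
  have := inner_dualVec E n ((EuclideanSpace.equiv (Fin d) ℝ).symm (E.mulVec (Pi.single i 1)))
  rw [h, coordL_mulVec hE, inner_zero_left] at this
  simp [Pi.single_apply] at this
  simpa using this.symm

lemma integral_chi {d p : ℕ} {E : Fin p → Matrix (Fin d) (Fin d) ℝ}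
    (hE : ∀ j, IsUnit (E j).det) (hinc : Incommensurate E)
    (μ : Measure (Hull E)) [IsProbabilityMeasure μ]
    (hμ : ∀ a : EuclideanSpace ℝ (Fin d), Measure.map (diagT E a) μ = μ)
    (n : Fin p → Fin d → ℤ) : ∫ ω, chi hE n ω ∂μ = if n = 0 then 1 else 0 := by
  have := fun j => latticeGroup_closed (hE j)
  have := fun j => (quot_polish (hE j)).1
  have := fun j => (quot_polish (hE j)).2
  split_ifs with hn
  · subst hn
    simp [chi_zero]
  · set k := ∑ j, dualVec (E j) (n j) with hk
    have hk0 : k ≠ 0 := by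
      intro h0
      apply hn
      have := (hinc (fun j => dualVec (E j) (n j)) (fun j => dualVec_mem (hE j) _)).1 h0
      ext1 j
      exact dualVec_eq_zero (hE j) _ (this j)
    set a : EuclideanSpace ℝ (Fin d) := (1 / (2 * ⟪k, k⟫) : ℝ) • k with ha
    have hkk : ⟪k, k⟫ ≠ (0 : ℝ) := inner_self_ne_zero.2 hk0
    have hka : ∑ j, ∑ i, (n j i : ℝ) * coordL (E j) a i = 1 / 2 := by
      simp only [← inner_dualVec]
      rw [← sum_inner, ← hk, ha, inner_smul_right]
      field_simp
    have hT : Measurable (diagT E a) := by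
      have : Continuous (diagT E a) := by
        unfold diagT
        fun_prop
      exact this.measurable
    have hchi : ∀ ω, chi hE n (diagT E a ω) = - chi hE n ω := by
      intro ω
      rw [chi_apply, chi_apply, phase_diagT, hka, AddCircle.toCircle_add]
      have : ((AddCircle.toCircle (((1 / 2 : ℝ)) : AddCircle (1 : ℝ)) : Circle) : ℂ) = -1 := by
        rw [AddCircle.toCircle_apply_mk, Circle.coe_exp]
        rw [← Complex.exp_pi_mul_I]
        congr 2
        push_cast
        ring
      rw [Circle.coe_mul, this]
      ring
    have h1 : ∫ ω, chi hE n ω ∂μ = - ∫ ω, chi hE n ω ∂μ := by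
      conv_lhs => rw [← hμ a]
      rw [integral_map hT.aemeasurable (chi hE n).continuous.aestronglyMeasurable]
      simp only [hchi]
      exact integral_neg _
    exact self_eq_neg.1 h1

/-- Unique ergodicity: any translation-invariant Borel probability measure on the hull equals
the normalized Haar product measure, for incommensurate lattices. -/
theorem stmt9 {d p : ℕ} (E : Fin p → Matrix (Fin d) (Fin d) ℝ)
    (hE : ∀ j, IsUnit (E j).det) (hinc : Incommensurate E)
    (μ : Measure (Hull E)) [IsProbabilityMeasure μ]
    (hμ : ∀ a : EuclideanSpace ℝ (Fin d), Measure.map (diagT E a) μ = μ) :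
    μ = hullProb E := by
  have := fun j => latticeGroup_closed (hE j)
  have := fun j => (quot_polish (hE j)).1
  have := fun j => (quot_polish (hE j)).2
  obtain ⟨hP, hPinv⟩ := hullProb_inv E hE
  let S : Submonoid (Hull E →ᵇ ℂ) :=
    { carrier := Set.range (chi hE)
      one_mem' := ⟨0, chi_zero hE⟩
      mul_mem' := by
        rintro _ _ ⟨m, rfl⟩ ⟨n, rfl⟩
        exact ⟨m + n, chi_add hE m n⟩ }
  have hstar : star (S : Set (Hull E →ᵇ ℂ)) = S := by
    have h : ∀ f ∈ S, star f ∈ S := by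
      rintro _ ⟨n, rfl⟩
      exact ⟨-n, chi_neg hE n⟩
    ext f
    rw [Set.mem_star]
    exact ⟨fun hf => by simpa using h _ hf, fun hf => h _ hf⟩
  have hspan : ∀ g ∈ StarAlgebra.adjoin ℂ (S : Set (Hull E →ᵇ ℂ)),
      g ∈ Submodule.span ℂ (S : Set (Hull E →ᵇ ℂ)) := by
    intro g hg
    rw [← StarSubalgebra.mem_toSubalgebra, StarAlgebra.adjoin_toSubalgebra, hstar,
      Set.union_self, ← Subalgebra.mem_toSubmodule, Algebra.adjoin_eq_span,
      Submonoid.closure_eq] at hg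
    exact hg
  refine ext_of_forall_mem_subalgebra_integral_eq_of_polish (𝕜 := ℂ)
    (A := StarAlgebra.adjoin ℂ (S : Set (Hull E →ᵇ ℂ))) ?_ ?_
  · intro ω ω' hne
    have : ∃ j i, quotHom (hE j) (ω j) i ≠ quotHom (hE j) (ω' j) i := by
      by_contra! hcon
      exact hne (funext fun j => quotHom_injective (hE j) (funext fun i => hcon j i))
    obtain ⟨j, i, hji⟩ := this
    let n : Fin p → Fin d → ℤ := fun j' i' => if j' = j then (if i' = i then 1 else 0) else 0
    refine ⟨chi hE n, ⟨(chi hE n).toContinuousMap, ⟨chi hE n, ?_, rfl⟩, rfl⟩, ?_⟩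
    · exact StarAlgebra.subset_adjoin ℂ _ ⟨n, rfl⟩
    · have hph : ∀ ω : Hull E, phase hE n ω = quotHom (hE j) (ω j) i := by
        intro ω
        simp only [phase, n]
        rw [Finset.sum_eq_single j, Finset.sum_eq_single i]
        · simp
        · intro b _ hb; simp [hb]
        · simp
        · intro b _ hb; simp [hb]
        · simp
      rw [chi_apply, chi_apply, hph, hph]
      intro h
      exact hji (AddCircle.injective_toCircle one_ne_zero (Circle.ext h))
  · intro g hg
    have hg' := hspan g hg
    clear hg
    induction hg' using Submodule.span_induction with
    | mem x hx =>
      obtain ⟨n, rfl⟩ := hx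
      rw [integral_chi hE hinc μ hμ, integral_chi hE hinc _ hPinv]
    | zero => simp
    | add x y _ _ hx hy =>
      have hi : ∀ (ν : Measure (Hull E)) [IsFiniteMeasure ν] (f : Hull E →ᵇ ℂ),
        Integrable (fun ω => f ω) ν := fun ν _ f => f.integrable ν
      simp only [BoundedContinuousFunction.add_apply]
      rw [integral_add (hi _ x) (hi _ y), integral_add (hi _ x) (hi _ y), hx, hy]
    | smul c x _ hx =>
      simp only [BoundedContinuousFunction.smul_apply]
      rw [integral_smul, integral_smul, hx]
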